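/- Let n be a positive integer. There exists a function f from real n×n matrices to real n×n matrices which is infinitely differentiable (C^∞) on the open set {M : det(M) > 0}, and such that for every M with det(M) > 0, f(M) lies in the special orthogonal group SO(n) and ‖f(M) − M‖_F ≤ ‖R − M‖_F for every R ∈ SO(n). That is, the special symmetric orthogonalization SVDO⁺(M), the Frobenius-nearest rotation matrix to M, is a smooth function of M on the set of matrices with positive determinant. -/

import Mathlib

open Matrix

/-- The Frobenius norm of a real square matrix. -/
noncomputable def frobNorm {n : ℕ} (M : Matrix (Fin n) (Fin n) ℝ) : ℝ :=
  Real.sqrt (∑ i, ∑ j, (M i j) ^ 2)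

open scoped MatrixOrder Matrix.Norms.L2Operator

namespace Matrix

variable {m : Type*} [Fintype m]

/-- The Sylvester operator `H ↦ P * H + H * P` of a positive definite matrix is injective. -/
lemma PosDef.eq_zero_of_mul_add_mul_eq_zero {P H : Matrix m m ℝ} (hP : P.PosDef)
    (h : P * H + H * P = 0) : H = 0 := by
  have h₁ : (Hᴴ * P * H).PosSemidef := hP.posSemidef.conjTranspose_mul_mul_same H
  have h₂ : (H * P * Hᴴ).PosSemidef := hP.posSemidef.mul_mul_conjTranspose_same H
  have hsum : (Hᴴ * P * H).trace + (H * P * Hᴴ).trace = 0 := by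
    rw [trace_mul_comm (H * P) Hᴴ, ← trace_add, Matrix.mul_assoc, ← Matrix.mul_add, h,
      Matrix.mul_zero, trace_zero]
  have hzero : H * P * Hᴴ = 0 :=
    h₂.trace_eq_zero_iff.mp (by linarith [h₁.trace_nonneg, h₂.trace_nonneg])
  refine funext fun i ↦ ?_
  by_contra hi
  have hpos := hP.dotProduct_mulVec_pos (x := H i) hi
  have hdiag : star (H i) ⬝ᵥ P *ᵥ H i = (H * P * Hᴴ) i i := by
    simp only [star_trivial, dotProduct_mulVec, Matrix.mul_apply_eq_vecMul]
    simp [dotProduct, vecMul]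
  rw [hdiag, hzero] at hpos
  exact lt_irrefl _ hpos

variable [DecidableEq m]

/-- The derivative `H ↦ P * H + H * P` of squaring at a positive definite matrix, as a continuous
linear equivalence. -/
noncomputable def PosDef.sylvesterEquiv {P : Matrix m m ℝ} (hP : P.PosDef) :
    Matrix m m ℝ ≃L[ℝ] Matrix m m ℝ :=
  (LinearEquiv.ofInjectiveEndo (LinearMap.mulLeft ℝ P + LinearMap.mulRight ℝ P)
    ((injective_iff_map_eq_zero _).mpr fun H hH ↦
      hP.eq_zero_of_mul_add_mul_eq_zero (by simpa using hH))).toContinuousLinearEquiv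

lemma PosDef.hasFDerivAt_mul_self {P : Matrix m m ℝ} (hP : P.PosDef) :
    HasFDerivAt (fun X : Matrix m m ℝ ↦ X * X)
      (hP.sylvesterEquiv : Matrix m m ℝ →L[ℝ] Matrix m m ℝ) P := by
  refine ((hasFDerivAt_id P).mul' (hasFDerivAt_id P)).congr_fderiv ?_
  ext1 H
  simp [PosDef.sylvesterEquiv]

lemma posDef_cfcAbs {M : Matrix m m ℝ} (hM : M.det ≠ 0) : (CFC.abs M).PosDef := by
  have hsq : (CFC.abs M).det * (CFC.abs M).det = M.det * M.det := by
    rw [← det_mul, CFC.abs_mul_abs, star_eq_conjTranspose, conjTranspose_eq_transpose_of_trivial,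
      det_mul, det_transpose]
  refine (CFC.abs_nonneg M).posSemidef.posDef_iff_det_ne_zero.mpr fun h ↦ ?_
  simp_all

/-- The absolute value `(Mᴴ * M) ^ (1 / 2)` is smooth at invertible matrices. -/
lemma contDiffAt_cfcAbs {M : Matrix m m ℝ} (hM : M.det ≠ 0) :
    ContDiffAt ℝ (⊤ : ℕ∞) (CFC.abs : Matrix m m ℝ → Matrix m m ℝ) M := by
  have hP := posDef_cfcAbs hM
  have hsq : ContDiffAt ℝ (⊤ : ℕ∞) (fun X : Matrix m m ℝ ↦ X * X) (CFC.abs M) := by fun_prop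
  set e := hsq.toOpenPartialHomeomorph _ hP.hasFDerivAt_mul_self (by simp)
  have hinv : ContDiffAt ℝ (⊤ : ℕ∞) e.symm (star M * M) := by
    rw [← CFC.abs_mul_abs]
    exact hsq.to_localInverse hP.hasFDerivAt_mul_self (by simp)
  have hstar : ContDiff ℝ (⊤ : ℕ∞) (fun X : Matrix m m ℝ ↦ star X) :=
    (starL' ℝ : Matrix m m ℝ ≃L[ℝ] Matrix m m ℝ).contDiff
  refine (hinv.comp M (f := fun X : Matrix m m ℝ ↦ star X * X)
    (hstar.mul contDiff_id).contDiffAt).congr_of_eventuallyEq ?_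
  filter_upwards [CFC.continuous_abs.continuousAt.eventually_mem (e.open_source.mem_nhds
    (hsq.mem_toOpenPartialHomeomorph_source hP.hasFDerivAt_mul_self (by simp)))] with X hX
  rw [Function.comp_apply, ← CFC.abs_mul_abs]
  exact (e.left_inv hX).symm

/-- The orthogonal factor `M * |M|⁻¹` of the polar decomposition of `M`. -/
noncomputable def polarFactor (M : Matrix m m ℝ) : Matrix m m ℝ :=
  M * (CFC.abs M)⁻¹

lemma polarFactor_mul_cfcAbs {M : Matrix m m ℝ} (hM : M.det ≠ 0) :
    polarFactor M * CFC.abs M = M :=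
  nonsing_inv_mul_cancel_right _ _ (posDef_cfcAbs hM).det_pos.ne'.isUnit

lemma transpose_mul_polarFactor {M : Matrix m m ℝ} (hM : M.det ≠ 0) :
    (polarFactor M)ᵀ * polarFactor M = 1 := by
  have hP := posDef_cfcAbs hM
  have hu : IsUnit (CFC.abs M).det := hP.det_pos.ne'.isUnit
  have hsymm : (CFC.abs M)ᵀ = CFC.abs M := by simpa using hP.isHermitian.eq
  have hsq : CFC.abs M * CFC.abs M = Mᵀ * M := by
    simpa [star_eq_conjTranspose] using CFC.abs_mul_abs M
  rw [polarFactor, transpose_mul, transpose_nonsing_inv, hsymm, Matrix.mul_assoc,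
    ← Matrix.mul_assoc Mᵀ, ← hsq, mul_nonsing_inv_cancel_right _ _ hu, nonsing_inv_mul _ hu]

lemma det_polarFactor {M : Matrix m m ℝ} (hM : 0 < M.det) : (polarFactor M).det = 1 := by
  have hP := (posDef_cfcAbs hM.ne').det_pos
  have hmul := congrArg det (polarFactor_mul_cfcAbs hM.ne')
  have horth := congrArg det (transpose_mul_polarFactor hM.ne')
  rw [det_mul] at hmul horth
  rw [det_transpose, det_one] at horth
  have hpos : 0 < (polarFactor M).det := pos_of_mul_pos_left (hmul ▸ hM) hP.le
  nlinarith

lemma contDiffAt_polarFactor {M : Matrix m m ℝ} (hM : M.det ≠ 0) :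
    ContDiffAt ℝ (⊤ : ℕ∞) (polarFactor : Matrix m m ℝ → Matrix m m ℝ) M := by
  obtain ⟨u, hu⟩ := (posDef_cfcAbs hM).isUnit
  have hinv : ContDiffAt ℝ (⊤ : ℕ∞) (fun X : Matrix m m ℝ ↦ (CFC.abs X)⁻¹) M := by
    simp only [nonsing_inv_eq_ringInverse]
    exact ContDiffAt.comp M (hu ▸ contDiffAt_ringInverse ℝ u) (contDiffAt_cfcAbs hM)
  exact contDiffAt_id.mul hinv

lemma trace_transpose_mul_self_polarFactor_sub_le {M R : Matrix m m ℝ} (hM : M.det ≠ 0)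
    (hR : Rᵀ * R = 1) :
    ((polarFactor M - M)ᵀ * (polarFactor M - M)).trace ≤ ((R - M)ᵀ * (R - M)).trace := by
  have hP := posDef_cfcAbs hM
  have hQ := transpose_mul_polarFactor hM
  have hQP := polarFactor_mul_cfcAbs hM
  set P := CFC.abs M
  set Q := polarFactor M
  have hsymm : Pᵀ = P := by simpa using hP.isHermitian.eq
  have hnonneg := (hP.posSemidef.mul_mul_conjTranspose_same (Q - R)).trace_nonneg
  have hPQ : P * Qᵀ = Mᵀ := by rw [← hQP, transpose_mul, hsymm]
  have hRPR : (R * P * Rᵀ).trace = P.trace := by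
    rw [trace_mul_comm, ← Matrix.mul_assoc, hR, Matrix.one_mul]
  have hQM : (Qᵀ * M).trace = P.trace := by
    rw [← hQP, ← Matrix.mul_assoc, hQ, Matrix.one_mul]
  have hMQ : (Mᵀ * Q).trace = P.trace := by
    rw [← trace_transpose, transpose_mul, transpose_transpose, hQM]
  have hMR : (Mᵀ * R).trace = (Rᵀ * M).trace := by
    rw [← trace_transpose, transpose_mul, transpose_transpose]
  have hexp : ((Q - R) * P * (Q - R)ᴴ).trace = 2 * P.trace - 2 * (Rᵀ * M).trace := by
    rw [conjTranspose_eq_transpose_of_trivial, transpose_sub, Matrix.mul_sub, Matrix.sub_mul,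
      Matrix.sub_mul, Matrix.sub_mul, hQP, Matrix.mul_assoc R P Qᵀ, hPQ]
    simp only [trace_sub]
    rw [hRPR, trace_mul_comm M, hQM, trace_mul_comm R, hMR, trace_mul_comm M]
    ring
  simp only [transpose_sub, Matrix.sub_mul, Matrix.mul_sub, trace_sub, hQ, hR]
  linarith

end Matrix

lemma frobNorm_eq_sqrt_trace {n : ℕ} (M : Matrix (Fin n) (Fin n) ℝ) :
    frobNorm M = √(Mᵀ * M).trace := by
  rw [frobNorm, Finset.sum_comm]
  simp [trace, Matrix.mul_apply, sq]

/-- **Smoothness of special symmetric orthogonalization.** There is a map `f`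
on real `n×n` matrices (viewed as elements of the pi type `Fin n → Fin n → ℝ`)
that is `C^∞` on the open set of matrices with positive determinant, and such
that whenever `det M > 0`, `f M` lies in `SO(n)` and is a Frobenius-nearest
rotation matrix to `M`. -/
theorem special_svd_orthogonalization_smooth (n : ℕ) (hn : 0 < n) :
    ∃ f : (Fin n → Fin n → ℝ) → (Fin n → Fin n → ℝ),
      ContDiffOn ℝ (⊤ : ℕ∞) f {M : Fin n → Fin n → ℝ | 0 < (Matrix.of M).det} ∧
      ∀ M : Fin n → Fin n → ℝ, 0 < (Matrix.of M).det →
        (Matrix.of (f M))ᵀ * Matrix.of (f M) = 1 ∧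
        (Matrix.of (f M)).det = 1 ∧
        ∀ R : Matrix (Fin n) (Fin n) ℝ, Rᵀ * R = 1 → R.det = 1 →
          frobNorm (Matrix.of (f M) - Matrix.of M) ≤ frobNorm (R - Matrix.of M) := by
  let e : (Fin n → Fin n → ℝ) ≃L[ℝ] Matrix (Fin n) (Fin n) ℝ :=
    (Matrix.ofLinearEquiv ℝ).toContinuousLinearEquiv
  refine ⟨fun M ↦ e.symm (polarFactor (e M)), fun M hM ↦ ?_, fun M hM ↦
    ⟨transpose_mul_polarFactor hM.ne', det_polarFactor hM, fun R hR _ ↦ ?_⟩⟩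
  · exact (e.symm.contDiff.contDiffAt.comp M ((contDiffAt_polarFactor (M := e M) hM.ne').comp M
      e.contDiff.contDiffAt)).contDiffWithinAt
  · rw [frobNorm_eq_sqrt_trace, frobNorm_eq_sqrt_trace]
    exact Real.sqrt_le_sqrt (trace_transpose_mul_self_polarFactor_sub_le hM.ne' hR)
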